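/- Fix 1 ≤ i ≤ n−1 and consider E_i(ξ̄) = −k_i(u_{i+1}−u_i) ln(F(ξ_{i+1}/a_i) − F(ξ_i/a_i)) as a function of (ξ_i, ξ_{i+1}) with ξ_i < ξ_{i+1}. With x_i = ξ_{i+1}/a_i, y_i = ξ_i/a_i, β_i^- = (κ_i(u_{i+1}−u_i) F'(y_i)/(F(x_i)−F(y_i))) · (−y_i/2 − (F'(x_i)−F'(y_i))/(F(x_i)−F(y_i))), β_i^+ = (κ_i(u_{i+1}−u_i) F'(x_i)/(F(x_i)−F(y_i))) · (x_i/2 + (F'(x_i)−F'(y_i))/(F(x_i)−F(y_i))), and γ_i = κ_i(u_{i+1}−u_i) F'(x_i)F'(y_i)/(F(x_i)−F(y_i))², the second partial derivatives are: ∂²E_i/∂ξ_i² = β_i^- + γ_i, ∂²E_i/∂ξ_{i+1}² = β_i^+ + γ_i, and ∂²E_i/∂ξ_i∂ξ_{i+1} = −γ_i. -/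

import Mathlib

open Real Filter Finset

/-- The rescaled Gaussian cumulative distribution function
`F(ξ) = (1/(2√π)) ∫_{-∞}^{ξ} e^{-s²/4} ds`. -/
noncomputable def F (x : ℝ) : ℝ :=
  (1 / (2 * Real.sqrt Real.pi)) * ∫ s in Set.Iio x, Real.exp (-s ^ 2 / 4)

/-- The derivative `F'(ξ) = (1/(2√π)) e^{-ξ²/4}`. -/
noncomputable def F' (x : ℝ) : ℝ :=
  (1 / (2 * Real.sqrt Real.pi)) * Real.exp (-x ^ 2 / 4)

theorem hasDerivAt_F (x : ℝ) : HasDerivAt F (F' x) x := by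
  have hint : MeasureTheory.Integrable (fun s : ℝ => Real.exp (-s ^ 2 / 4)) := by
    refine (integrable_exp_neg_mul_sq (b := 1 / 4) (by norm_num)).congr ?_
    filter_upwards with s
    congr 1
    ring
  have hcont : Continuous (fun s : ℝ => Real.exp (-s ^ 2 / 4)) := by fun_prop
  have hF : F = fun x => (1 / (2 * Real.sqrt Real.pi)) *
      ((∫ s in Set.Iic 0, Real.exp (-s ^ 2 / 4)) + ∫ s in (0 : ℝ)..x, Real.exp (-s ^ 2 / 4)) := by
    funext z
    rw [F, ← MeasureTheory.integral_Iic_eq_integral_Iio,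
      ← intervalIntegral.integral_Iic_sub_Iic hint.integrableOn hint.integrableOn,
      add_sub_cancel]
  rw [hF]
  exact ((intervalIntegral.integral_hasDerivAt_right (hcont.intervalIntegrable _ _)
    (hcont.stronglyMeasurableAtFilter _ _) hcont.continuousAt).const_add _).const_mul _

theorem F'_pos (x : ℝ) : 0 < F' x := by
  unfold F'
  positivity

theorem strictMono_F : StrictMono F :=
  strictMono_of_deriv_pos fun x => by
    rw [(hasDerivAt_F x).deriv]
    exact F'_pos x

theorem hasDerivAt_F' (x : ℝ) : HasDerivAt F' (-x / 2 * F' x) x := by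
  have h : HasDerivAt (fun z : ℝ => -z ^ 2 / 4) (-(2 * x) / 4) x := by
    simpa using ((hasDerivAt_pow 2 x).neg.div_const 4)
  refine (h.exp.const_mul (1 / (2 * Real.sqrt Real.pi))).congr_deriv ?_
  unfold F'
  ring

theorem hasDerivAt_F_div (c x : ℝ) : HasDerivAt (fun z => F (z / c)) (F' (x / c) / c) x := by
  refine ((hasDerivAt_F (x / c)).comp x ((hasDerivAt_id x).div_const c)).congr_deriv ?_
  ring

theorem hasDerivAt_F'_div (c x : ℝ) :
    HasDerivAt (fun z => F' (z / c)) (-(x / c) / 2 * F' (x / c) / c) x := by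
  refine ((hasDerivAt_F' (x / c)).comp x ((hasDerivAt_id x).div_const c)).congr_deriv ?_
  ring

theorem F_div_sub_pos {c p q : ℝ} (hc : 0 < c) (hpq : p < q) : 0 < F (q / c) - F (p / c) :=
  sub_pos.2 (strictMono_F (div_lt_div_of_pos_right hpq hc))

/-- First partial derivative of the energy in the left endpoint. -/
theorem deriv_energy_left {c p q : ℝ} (K : ℝ) (hc : 0 < c) (hpq : p < q) :
    deriv (fun z => -(K * Real.log (F (q / c) - F (z / c)))) p =
      K / c * (F' (p / c) / (F (q / c) - F (p / c))) := by
  have hD := F_div_sub_pos hc hpq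
  rw [((((hasDerivAt_F_div c p).const_sub (F (q / c))).log hD.ne').const_mul K).fun_neg.deriv]
  ring

/-- First partial derivative of the energy in the right endpoint. -/
theorem deriv_energy_right {c p q : ℝ} (K : ℝ) (hc : 0 < c) (hpq : p < q) :
    deriv (fun z => -(K * Real.log (F (z / c) - F (p / c)))) q =
      -(K / c * (F' (q / c) / (F (q / c) - F (p / c)))) := by
  have hD := F_div_sub_pos hc hpq
  rw [((((hasDerivAt_F_div c q).sub_const (F (p / c))).log hD.ne').const_mul K).fun_neg.deriv]
  ring

/-- For `1 ≤ i ≤ n−1`, the function `E_i(ξ_i, ξ_{i+1}) = −k_i(u_{i+1}−u_i) ln(F(ξ_{i+1}/a_i) −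
F(ξ_i/a_i))` on `{ξ_i < ξ_{i+1}}` has second partial derivatives
`∂²E_i/∂ξ_i² = β_i^- + γ_i`, `∂²E_i/∂ξ_{i+1}² = β_i^+ + γ_i`,
`∂²E_i/∂ξ_i∂ξ_{i+1} = −γ_i`. -/
theorem stmt14 (n : ℕ) (hn : 1 ≤ n) (u a k : ℕ → ℝ)
    (hu : ∀ j ≤ n, u j < u (j + 1))
    (ha : ∀ j ≤ n, 0 < a j)
    (hk : ∀ j ≤ n, 0 < k j)
    (i : ℕ) (hi1 : 1 ≤ i) (hi2 : i ≤ n - 1)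
    (s t : ℝ) (hst : s < t) :
    let Ei : ℝ → ℝ → ℝ := fun p q =>
      -(k i * (u (i + 1) - u i) * Real.log (F (q / a i) - F (p / a i)))
    let x : ℝ := t / a i
    let y : ℝ := s / a i
    let κ : ℝ := k i / a i ^ 2
    let βm : ℝ := κ * (u (i + 1) - u i) * F' y / (F x - F y) *
      (-y / 2 - (F' x - F' y) / (F x - F y))
    let βp : ℝ := κ * (u (i + 1) - u i) * F' x / (F x - F y) *
      (x / 2 + (F' x - F' y) / (F x - F y))
    let γ : ℝ := κ * (u (i + 1) - u i) * F' x * F' y / (F x - F y) ^ 2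
    deriv (fun p => deriv (fun p' => Ei p' t) p) s = βm + γ ∧
    deriv (fun q => deriv (fun q' => Ei s q') q) t = βp + γ ∧
    deriv (fun q => deriv (fun p => Ei p q) s) t = -γ := by
  intro Ei x y κ βm βp γ
  have hc : 0 < a i := ha i (by omega)
  have hD : F x - F y ≠ 0 := (F_div_sub_pos hc hst).ne'
  have hc0 : a i ≠ 0 := hc.ne'
  refine ⟨?_, ?_, ?_⟩
  · have he : (fun p => deriv (fun p' => Ei p' t) p) =ᶠ[nhds s] fun p =>
        k i * (u (i + 1) - u i) / a i * (F' (p / a i) / (F (t / a i) - F (p / a i))) := by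
      filter_upwards [Iio_mem_nhds hst] with p hp
      exact deriv_energy_left _ hc hp
    rw [he.deriv_eq, (((hasDerivAt_F'_div (a i) s).fun_div
      ((hasDerivAt_F_div (a i) s).const_sub (F (t / a i))) hD).const_mul _).deriv]
    change _ / a i * ((-y / 2 * F' y / a i * (F x - F y) - F' y * -(F' y / a i)) /
      (F x - F y) ^ 2) = _
    simp only [βm, γ, κ]
    clear_value x y
    field_simp
    ring
  · have he : (fun q => deriv (fun q' => Ei s q') q) =ᶠ[nhds t] fun q =>
        -(k i * (u (i + 1) - u i) / a i * (F' (q / a i) / (F (q / a i) - F (s / a i)))) := by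
      filter_upwards [Ioi_mem_nhds hst] with q hq
      exact deriv_energy_right _ hc hq
    rw [he.deriv_eq, (((hasDerivAt_F'_div (a i) t).fun_div
      ((hasDerivAt_F_div (a i) t).sub_const (F (s / a i))) hD).const_mul _).fun_neg.deriv]
    change -(_ / a i * ((-x / 2 * F' x / a i * (F x - F y) - F' x * (F' x / a i)) /
      (F x - F y) ^ 2)) = _
    simp only [βp, γ, κ]
    clear_value x y
    field_simp
    ring
  · have he : (fun q => deriv (fun p => Ei p q) s) =ᶠ[nhds t] fun q =>
        k i * (u (i + 1) - u i) / a i * (F' (s / a i) / (F (q / a i) - F (s / a i))) := by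
      filter_upwards [Ioi_mem_nhds hst] with q hq
      exact deriv_energy_left _ hc hq
    rw [he.deriv_eq, (((hasDerivAt_const t (F' (s / a i))).fun_div
      ((hasDerivAt_F_div (a i) t).sub_const (F (s / a i))) hD).const_mul _).deriv]
    change _ / a i * ((0 * (F x - F y) - F' y * (F' x / a i)) / (F x - F y) ^ 2) = _
    simp only [γ, κ]
    clear_value x y
    field_simp
    ring
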